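/- Let n ≥ 2 and suppose θ ↦ θ' is a map S_n → S_n such that for every transposition (i j) with {i,j} an edge of a fixed n-cycle graph on {1,...,n}, and every θ ∈ S_n, one has ((i j)·θ)' ∈ {θ', θ^{−1}(i j)θ · θ'}. Then θ ↦ θ' is either a constant map or of the form θ' = (τ·θ)^{−1} for some fixed τ ∈ S_n. -/

import Mathlib

open Equiv

/-- A submonoid of permutations containing the transposition of every edge of a walk contains the
transposition of its endpoints. -/
theorem swap_mem_of_walk {α : Type*} [DecidableEq α] {G : SimpleGraph α}
    (M : Submonoid (Perm α)) {x y : α} (w : G.Walk x y)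
    (h : ∀ i ∈ w.support, ∀ j ∈ w.support, G.Adj i j → swap i j ∈ M) : swap x y ∈ M := by
  induction w with
  | nil => rw [swap_self]; exact M.one_mem
  | cons hadj w ih =>
    refine SubmonoidClass.swap_mem_trans M (h _ (by simp) _ (by simp) hadj) (ih ?_)
    intro i hi j hj
    exact h i (by simp [hi]) j (by simp [hj])

/-- The edge transpositions of a connected graph generate the symmetric group. -/
theorem submonoid_eq_top_of_swap_mem {α : Type*} [DecidableEq α] [Finite α] {G : SimpleGraph α}
    (hG : G.Connected) (M : Submonoid (Perm α)) (h : ∀ i j, G.Adj i j → swap i j ∈ M) :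
    M = ⊤ := by
  rw [eq_top_iff, ← Perm.mclosure_isSwap, Submonoid.closure_le]
  rintro _ ⟨x, y, -, rfl⟩
  obtain ⟨w⟩ := hG.preconnected x y
  exact swap_mem_of_walk M w fun i _ j _ hij => h i j hij

/-- In a finite 2-regular graph, two distinct neighbours of `p` are joined by a walk avoiding
`p`. -/
theorem exists_walk_avoiding {α : Type*} [Finite α] {G : SimpleGraph α}
    (hreg : ∀ v, (G.neighborSet v).ncard = 2) {p q r : α} (hq : G.Adj p q) (hr : G.Adj p r)
    (hqr : q ≠ r) : ∃ w : G.Walk r q, p ∉ w.support := by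
  classical
  have hcyc : G.IsCycles := fun v _ => hreg v
  obtain ⟨w, hw⟩ := (hcyc.reachable_deleteEdges hq).exists_isPath
  cases w with
  | nil => exact absurd rfl hq.ne
  | @cons _ s _ h w =>
    rw [SimpleGraph.Walk.cons_isPath_iff] at hw
    rw [SimpleGraph.deleteEdges_adj] at h
    obtain rfl : s = r := by
      obtain ⟨x, y, -, hxy⟩ := Set.ncard_eq_two.1 (hreg p)
      have hs : s ∈ G.neighborSet p := h.1
      have hq : q ∈ G.neighborSet p := hq
      have hr : r ∈ G.neighborSet p := hr
      have hsq : s ≠ q := by rintro rfl; exact h.2 rfl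
      simp only [hxy, Set.mem_insert_iff, Set.mem_singleton_iff] at hs hq hr
      grind
    exact ⟨w.mapLe (SimpleGraph.deleteEdges_le _), by simpa using hw.2⟩

section EdgeSteps

variable {α : Type*} [DecidableEq α] {G : SimpleGraph α} {g : Perm α → Perm α}

/-- The permutations `k` such that `g (k * θ)` always differs from `g θ` by a left factor
fixing `p`. -/
def fixingSteps (g : Perm α → Perm α) (p : α) : Submonoid (Perm α) where
  carrier := {k | ∀ θ, ∃ k' : Perm α, k' p = p ∧ g (k * θ) = k' * g θ}
  one_mem' θ := ⟨1, rfl, by simp⟩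
  mul_mem' {a b} ha hb θ := by
    obtain ⟨b', hb', hbθ⟩ := hb θ
    obtain ⟨a', ha', haθ⟩ := ha (b * θ)
    exact ⟨a' * b', by simp [ha', hb'], by rw [mul_assoc, haθ, hbθ, mul_assoc]⟩

/-- `g` changes along the edge from `θ` to `swap p q * θ`. -/
def Crosses (g : Perm α → Perm α) (p q : α) (θ : Perm α) : Prop :=
  g (swap p q * θ) = swap p q * g θ

theorem Crosses.symm {p q : α} {θ : Perm α} (h : Crosses g p q θ) : Crosses g q p θ := by
  unfold Crosses at *
  rwa [swap_comm]

theorem Crosses.swap_mul_self {p q : α} {θ : Perm α} (h : Crosses g p q θ) :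
    Crosses g p q (swap p q * θ) := by
  unfold Crosses at *
  rw [h, swap_mul_self_mul, swap_mul_self_mul]

theorem Crosses.swap_mul_of_disjoint
    (hg : ∀ i j, G.Adj i j → ∀ θ, g (swap i j * θ) = g θ ∨ g (swap i j * θ) = swap i j * g θ)
    {p q i j : α} {θ : Perm α} (h : Crosses g p q θ) (hpq : G.Adj p q) (hij : G.Adj i j)
    (hip : i ≠ p) (hiq : i ≠ q) (hjp : j ≠ p) (hjq : j ≠ q) :
    Crosses g p q (swap i j * θ) := by
  have hcomm : swap p q * (swap i j * θ) = swap i j * (swap p q * θ) := by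
    ext x
    simp only [Perm.mul_apply, swap_apply_def]
    have := hpq.ne
    have := hij.ne
    grind
  have hp : swap i j p = p := swap_apply_of_ne_of_ne hip.symm hjp.symm
  have hq : swap i j q = q := swap_apply_of_ne_of_ne hiq.symm hjq.symm
  refine (hg p q hpq (swap i j * θ)).resolve_left fun hc => hpq.ne ?_
  rw [hcomm] at hc
  have key := congrArg (fun σ : Perm α => σ ((g θ)⁻¹ p)) hc
  unfold Crosses at h
  rcases hg i j hij θ with h1 | h1 <;> rcases hg i j hij (swap p q * θ) with h2 | h2 <;>
    simp [h1, h2, h, hp, hq] at key <;> exact key.symm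

theorem Crosses.of_adj
    (hg : ∀ i j, G.Adj i j → ∀ θ, g (swap i j * θ) = g θ ∨ g (swap i j * θ) = swap i j * g θ)
    {p q r : α} {θ : Perm α} (h : Crosses g p q θ) (hpq : G.Adj p q) (hpr : G.Adj p r)
    (hqr : q ≠ r) {w : G.Walk r q} (hw : p ∉ w.support) :
    Crosses g p r θ ∧ Crosses g p r (swap p q * θ) := by
  have hmem : swap r q ∈ fixingSteps g p := by
    refine swap_mem_of_walk _ w fun i hi j hj hij θ => ?_
    rcases hg i j hij θ with h | h
    · exact ⟨1, rfl, by simpa using h⟩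
    · exact ⟨swap i j, swap_apply_of_ne_of_ne (by rintro rfl; exact hw hi)
        (by rintro rfl; exact hw hj), h⟩
  obtain ⟨k, hk, hkθ⟩ := hmem (swap p r * θ)
  have hword : swap p q * θ = swap p r * (swap r q * (swap p r * θ)) := by
    ext x
    simp only [Perm.mul_apply, swap_apply_def]
    have := hpq.ne
    have := hpr.ne
    grind
  have hword' : swap p r * (swap p q * θ) = swap r q * (swap p r * θ) := by
    rw [hword, swap_mul_self_mul]
  have hpq' := hpq.ne
  have hpr' := hpr.ne
  unfold Crosses at *
  have h3 := hg p r hpr (swap p q * θ)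
  rw [hword', hkθ, h] at h3
  rw [hword', hkθ, h]
  rcases hg p r hpr θ with h1 | h1 <;> rw [h1] at h3 ⊢ <;> rcases h3 with h3 | h3
  · have := congrArg (fun σ : Perm α => σ ((g θ)⁻¹ p)) h3
    simp [hk] at this
    exact absurd this hpq'
  · have := congrArg (fun σ : Perm α => σ ((g θ)⁻¹ p)) h3
    simp [hk, swap_apply_of_ne_of_ne hpq'.symm hqr] at this
    exact absurd this hpq'
  · have := congrArg (fun σ : Perm α => σ ((g θ)⁻¹ r)) h3
    simp [hk, swap_apply_of_ne_of_ne hpr'.symm hqr.symm] at this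
    exact absurd this hpr'
  · exact ⟨rfl, h3⟩

theorem Crosses.swap_mul [Finite α]
    (hreg : ∀ v, (G.neighborSet v).ncard = 2)
    (hg : ∀ i j, G.Adj i j → ∀ θ, g (swap i j * θ) = g θ ∨ g (swap i j * θ) = swap i j * g θ)
    {p q i j : α} {θ : Perm α} (h : Crosses g p q θ) (hpq : G.Adj p q) (hij : G.Adj i j) :
    Crosses g p q (swap i j * θ) := by
  have shared : ∀ {p q r : α}, Crosses g p q θ → G.Adj p q → G.Adj p r →
      Crosses g p q (swap p r * θ) := by
    intro p q r h hpq hpr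
    by_cases hqr : q = r
    · exact hqr ▸ h.swap_mul_self
    · obtain ⟨w, hw⟩ := exists_walk_avoiding hreg hpq hpr hqr
      have hr := (h.of_adj hg hpq hpr hqr hw).1
      exact (hr.of_adj hg hpr hpq (Ne.symm hqr) (w := w.reverse) (by simpa using hw)).2
  by_cases hip : i = p
  · subst hip; exact shared h hpq hij
  by_cases hjp : j = p
  · subst hjp; rw [swap_comm]; exact shared h hpq hij.symm
  by_cases hiq : i = q
  · subst hiq; exact (shared h.symm hpq.symm hij).symm
  by_cases hjq : j = q
  · subst hjq; rw [swap_comm]; exact (shared h.symm hpq.symm hij.symm).symm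
  exact h.swap_mul_of_disjoint hg hpq hij hip hiq hjp hjq

/-- Along the edges of a cycle, a single crossing forces all of them. -/
theorem Crosses.forall [Finite α] (hconn : G.Connected)
    (hreg : ∀ v, (G.neighborSet v).ncard = 2)
    (hg : ∀ i j, G.Adj i j → ∀ θ, g (swap i j * θ) = g θ ∨ g (swap i j * θ) = swap i j * g θ)
    {p q : α} {θ : Perm α} (h : Crosses g p q θ) (hpq : G.Adj p q) {i j : α} (hij : G.Adj i j)
    (σ : Perm α) : Crosses g i j σ := by
  have all_perm : ∀ σ, Crosses g p q σ := by
    let M : Submonoid (Perm α) :=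
      { carrier := {k | ∀ θ, Crosses g p q θ → Crosses g p q (k * θ)}
        one_mem' := fun θ h => by simpa using h
        mul_mem' := fun {a b} ha hb θ h => by
          rw [mul_assoc]; exact ha _ (hb _ h) }
    have hM : M = ⊤ := submonoid_eq_top_of_swap_mem hconn M
      fun i j hij θ h => h.swap_mul hreg hg hpq hij
    intro σ
    have : σ * θ⁻¹ ∈ M := hM ▸ Submonoid.mem_top _
    simpa using this θ h
  have step : ∀ {a b c : α}, G.Adj a b → (∀ σ, Crosses g a b σ) → G.Adj a c →
      ∀ σ, Crosses g a c σ := by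
    intro a b c hab h hac σ
    by_cases hbc : b = c
    · exact hbc ▸ h σ
    · obtain ⟨w, hw⟩ := exists_walk_avoiding hreg hab hac hbc
      exact ((h σ).of_adj hg hab hac hbc hw).1
  obtain ⟨w⟩ := hconn.preconnected p i
  suffices ∀ {a b : α}, G.Walk a b → (∀ c, G.Adj a c → ∀ σ, Crosses g a c σ) →
      ∀ c, G.Adj b c → ∀ σ, Crosses g b c σ from
    this w (fun c hc => step hpq all_perm hc) j hij σ
  intro a b w
  induction w with
  | nil => exact id
  | cons hab w ih =>
    exact fun h => ih fun c hc => step hab.symm (fun σ => (h _ hab σ).symm) hc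

end EdgeSteps

/-- Combinatorial lemma: if `θ ↦ θ'` is a map `S_n → S_n` such that for every
edge `{i, j}` of a fixed `n`-cycle graph (a connected 2-regular simple graph) on
`{1, …, n}` and every `θ`, `((i j)·θ)' ∈ {θ', θ⁻¹(i j)θ · θ'}`, then `θ ↦ θ'` is
either constant or of the form `θ' = (τ·θ)⁻¹` for a fixed `τ`. -/
theorem stmt15 (n : ℕ) (hn : 2 ≤ n) (G : SimpleGraph (Fin n))
    (hconn : G.Connected) (hreg : ∀ v, (G.neighborSet v).ncard = 2)
    (f : Equiv.Perm (Fin n) → Equiv.Perm (Fin n))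
    (hf : ∀ i j, G.Adj i j → ∀ θ : Equiv.Perm (Fin n),
      f (Equiv.swap i j * θ) = f θ ∨
      f (Equiv.swap i j * θ) = (θ⁻¹ * Equiv.swap i j * θ) * f θ) :
    (∃ c, ∀ θ, f θ = c) ∨ (∃ τ, ∀ θ, f θ = (τ * θ)⁻¹) := by
  let g : Perm (Fin n) → Perm (Fin n) := fun θ => θ * f θ
  have hg : ∀ i j, G.Adj i j → ∀ θ,
      g (swap i j * θ) = g θ ∨ g (swap i j * θ) = swap i j * g θ := by
    intro i j hij θ
    rcases hf i j hij θ with h | h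
    · right; simp only [g, h, mul_assoc]
    · left; simp only [g, h, mul_assoc, mul_inv_cancel_left, swap_mul_self_mul]
  by_cases hc : ∃ p q θ, G.Adj p q ∧ Crosses g p q θ
  · obtain ⟨p, q, θ, hpq, h⟩ := hc
    let M : Submonoid (Perm (Fin n)) :=
      { carrier := {k | ∀ θ, g (k * θ) = k * g θ}
        one_mem' := fun θ => by simp
        mul_mem' := fun {a b} ha hb θ => by rw [mul_assoc, ha, hb, mul_assoc] }
    have hM : M = ⊤ := submonoid_eq_top_of_swap_mem hconn M
      fun i j hij σ => h.forall hconn hreg hg hpq hij σ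
    refine Or.inl ⟨f 1, fun σ => ?_⟩
    have hσ : σ ∈ M := hM ▸ Submonoid.mem_top _
    simpa [g] using hσ 1
  · let M : Submonoid (Perm (Fin n)) :=
      { carrier := {k | ∀ θ, g (k * θ) = g θ}
        one_mem' := fun θ => by simp
        mul_mem' := fun {a b} ha hb θ => by rw [mul_assoc, ha, hb] }
    have hM : M = ⊤ := submonoid_eq_top_of_swap_mem hconn M
      fun i j hij σ => (hg i j hij σ).resolve_right fun h => hc ⟨i, j, σ, hij, h⟩
    refine Or.inr ⟨(f 1)⁻¹, fun σ => ?_⟩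
    have hσ : σ ∈ M := hM ▸ Submonoid.mem_top _
    have : σ * f σ = f 1 := by simpa [g] using hσ 1
    rw [mul_inv_rev, inv_inv, ← this, inv_mul_cancel_left]
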